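/- Let c_P(t) = Σ_{i=0}^n b_{i,n}(t) p_i be a Bézier curve of degree n with control points p_0, …, p_n ∈ ℝ^d, let 0 ≤ k ≤ n, and define q_i = Σ_{j=0}^{k} C(k,j) · (−1)^{k−j} · p_{i+j} for i = 0, …, n−k. Then the squared L² norm of the k-th derivative of the curve satisfies ∫₀¹ ‖d^k/dt^k c_P(t)‖² dt = (n!/(n−k)!)² · Σ_{i=0}^{n−k} Σ_{j=0}^{n−k} (1/(2(n−k)+1)) · (C(n−k,i)·C(n−k,j))/C(2(n−k), i+j) · ⟨q_i, q_j⟩. -/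

import Mathlib

open scoped RealInnerProductSpace

/-- The Bernstein basis polynomial `b_{i,n}(t) = C(n,i) tⁱ (1-t)^{n-i}`. -/
noncomputable def bern (n i : ℕ) (t : ℝ) : ℝ :=
  (n.choose i : ℝ) * t ^ i * (1 - t) ^ (n - i)

/-- The Bézier curve of degree `n` with control points `p 0, …, p n` in `ℝ^d`. -/
noncomputable def bezier (d n : ℕ) (p : ℕ → EuclideanSpace ℝ (Fin d)) (t : ℝ) :
    EuclideanSpace ℝ (Fin d) :=
  ∑ i ∈ Finset.range (n + 1), bern n i t • p i

open scoped fwdDiff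

lemma bern_eq_eval_bernsteinPolynomial (n i : ℕ) (t : ℝ) :
    bern n i t = (bernsteinPolynomial ℝ n i).eval t := by
  simp [bern, bernsteinPolynomial]

lemma bern_eq_zero_of_lt {n i : ℕ} (h : n < i) (t : ℝ) : bern n i t = 0 := by
  simp [bern, Nat.choose_eq_zero_of_lt h]

lemma continuous_bern (n i : ℕ) : Continuous (bern n i) := by
  unfold bern
  fun_prop

lemma hasDerivAt_bern_zero (m : ℕ) (t : ℝ) :
    HasDerivAt (bern (m + 1) 0) (-((m + 1 : ℝ) * bern m 0 t)) t := by
  have h := (bernsteinPolynomial ℝ (m + 1) 0).hasDerivAt t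
  simp only [← bern_eq_eval_bernsteinPolynomial] at h
  refine h.congr_deriv ?_
  simp [bernsteinPolynomial.derivative_zero, bern_eq_eval_bernsteinPolynomial]
  ring

lemma hasDerivAt_bern_succ (m i : ℕ) (t : ℝ) :
    HasDerivAt (bern (m + 1) (i + 1)) ((m + 1 : ℝ) * (bern m i t - bern m (i + 1) t)) t := by
  have h := (bernsteinPolynomial ℝ (m + 1) (i + 1)).hasDerivAt t
  simpa [bernsteinPolynomial.derivative_succ, ← bern_eq_eval_bernsteinPolynomial] using h

lemma integral_bern {m i : ℕ} (hi : i ≤ m) : ∫ t in (0 : ℝ)..1, bern m i t = 1 / (m + 1) := by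
  have hm : (m + 1 : ℝ) ≠ 0 := by positivity
  induction i with
  | zero =>
    have h := intervalIntegral.integral_eq_sub_of_hasDerivAt (a := 0) (b := 1)
      (fun t _ => hasDerivAt_bern_zero m t)
      (((continuous_bern m 0).const_mul _).neg.intervalIntegrable _ _)
    rw [intervalIntegral.integral_neg, intervalIntegral.integral_const_mul] at h
    simp only [bern_eq_eval_bernsteinPolynomial, bernsteinPolynomial.eval_at_0,
      bernsteinPolynomial.eval_at_1] at h ⊢
    norm_num at h
    rw [eq_div_iff hm]
    linarith
  | succ i ih =>
    have h := intervalIntegral.integral_eq_sub_of_hasDerivAt (a := 0) (b := 1)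
      (fun t _ => hasDerivAt_bern_succ m i t)
      ((((continuous_bern m i).sub (continuous_bern m (i + 1))).const_mul _).intervalIntegrable _ _)
    rw [intervalIntegral.integral_const_mul, intervalIntegral.integral_sub
      ((continuous_bern m i).intervalIntegrable _ _)
      ((continuous_bern m (i + 1)).intervalIntegrable _ _), ih (by omega),
      bern_eq_eval_bernsteinPolynomial, bern_eq_eval_bernsteinPolynomial,
      bernsteinPolynomial.eval_at_0, bernsteinPolynomial.eval_at_1,
      if_neg (by omega), if_neg (by omega), sub_zero, mul_eq_zero] at h
    exact (sub_eq_zero.mp (h.resolve_left hm)).symm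

lemma bern_mul_bern {m i j : ℕ} (hi : i ≤ m) (hj : j ≤ m) (t : ℝ) :
    bern m i t * bern m j t =
      (m.choose i * m.choose j : ℝ) / ((2 * m).choose (i + j) : ℝ) * bern (2 * m) (i + j) t := by
  have hc : ((2 * m).choose (i + j) : ℝ) ≠ 0 :=
    Nat.cast_ne_zero.mpr (Nat.choose_pos (by omega)).ne'
  have he : 2 * m - (i + j) = (m - i) + (m - j) := by omega
  simp only [bern, he, pow_add]
  field_simp

lemma integral_bern_mul_bern {m i j : ℕ} (hi : i ≤ m) (hj : j ≤ m) :
    ∫ t in (0 : ℝ)..1, bern m i t * bern m j t =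
      1 / (2 * m + 1) * (m.choose i * m.choose j : ℝ) / ((2 * m).choose (i + j) : ℝ) := by
  simp_rw [bern_mul_bern hi hj]
  rw [intervalIntegral.integral_const_mul, integral_bern (by omega)]
  push_cast
  ring

lemma hasDerivAt_bezier (d m : ℕ) (p : ℕ → EuclideanSpace ℝ (Fin d)) (t : ℝ) :
    HasDerivAt (bezier d (m + 1) p) ((m + 1 : ℝ) • bezier d m (Δ_[1] p) t) t := by
  have h : HasDerivAt (bezier d (m + 1) p)
      (∑ i ∈ Finset.range (m + 1),
        ((m + 1 : ℝ) * (bern m i t - bern m (i + 1) t)) • p (i + 1) +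
        (-((m + 1 : ℝ) * bern m 0 t)) • p 0) t := by
    have hfun : bezier d (m + 1) p = fun s =>
        ∑ i ∈ Finset.range (m + 1), bern (m + 1) (i + 1) s • p (i + 1) +
          bern (m + 1) 0 s • p 0 :=
      funext fun s => Finset.sum_range_succ' _ _
    rw [hfun]
    exact (HasDerivAt.fun_sum fun i _ => (hasDerivAt_bern_succ m i t).smul_const _).add
      ((hasDerivAt_bern_zero m t).smul_const _)
  convert h using 1
  have hshift : ∑ i ∈ Finset.range (m + 1), bern m i t • p i =
      ∑ i ∈ Finset.range (m + 1), bern m (i + 1) t • p (i + 1) + bern m 0 t • p 0 := by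
    rw [← Finset.sum_range_succ' (fun i => bern m i t • p i), Finset.sum_range_succ _ (m + 1),
      bern_eq_zero_of_lt (Nat.lt_succ_self m), zero_smul, add_zero]
  simp only [bezier, fwdDiff, smul_sub, Finset.sum_sub_distrib, hshift, mul_smul, sub_smul,
    neg_smul, ← Finset.smul_sum, smul_add]
  abel

lemma iteratedDeriv_bezier (d n : ℕ) {k : ℕ} (hk : k ≤ n) (p : ℕ → EuclideanSpace ℝ (Fin d)) :
    iteratedDeriv k (bezier d n p) =
      fun t => (n.descFactorial k : ℝ) • bezier d (n - k) ((fwdDiff 1)^[k] p) t := by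
  induction k with
  | zero => simp
  | succ k ih =>
    rw [iteratedDeriv_succ, ih (by omega)]
    obtain ⟨m, hm⟩ : ∃ m, n - k = m + 1 := ⟨n - k - 1, by omega⟩
    have hm' : n - (k + 1) = m := by omega
    funext t
    rw [hm, hm', ((hasDerivAt_bezier d m ((fwdDiff 1)^[k] p) t).fun_const_smul _).deriv, smul_smul,
      Function.iterate_succ_apply', Nat.descFactorial_succ, hm]
    push_cast
    rw [mul_comm]

lemma integral_norm_bezier_sq (d m : ℕ) (p : ℕ → EuclideanSpace ℝ (Fin d)) :
    ∫ t in (0 : ℝ)..1, ‖bezier d m p t‖ ^ 2 =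
      ∑ i ∈ Finset.range (m + 1), ∑ j ∈ Finset.range (m + 1),
        1 / (2 * m + 1) * (m.choose i * m.choose j : ℝ) / ((2 * m).choose (i + j) : ℝ) *
          ⟪p i, p j⟫ := by
  have hcont (i j : ℕ) : Continuous fun t => bern m i t * bern m j t * ⟪p i, p j⟫ :=
    ((continuous_bern m i).mul (continuous_bern m j)).mul_const _
  have hexp (t : ℝ) : ‖bezier d m p t‖ ^ 2 =
      ∑ i ∈ Finset.range (m + 1), ∑ j ∈ Finset.range (m + 1),
        bern m i t * bern m j t * ⟪p i, p j⟫ := by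
    simp only [← real_inner_self_eq_norm_sq, bezier, sum_inner, inner_sum, real_inner_smul_left,
      real_inner_smul_right, mul_assoc]
    exact Finset.sum_comm.trans (Finset.sum_congr rfl fun i _ => Finset.sum_congr rfl fun j _ => by
      ring)
  simp_rw [hexp]
  rw [intervalIntegral.integral_finsetSum fun i _ =>
    (continuous_finsetSum _ fun j _ => hcont i j).intervalIntegrable _ _]
  refine Finset.sum_congr rfl fun i hi => ?_
  rw [intervalIntegral.integral_finsetSum fun j _ => (hcont i j).intervalIntegrable _ _]
  refine Finset.sum_congr rfl fun j hj => ?_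
  rw [intervalIntegral.integral_mul_const, integral_bern_mul_bern
    (Finset.mem_range_succ_iff.mp hi) (Finset.mem_range_succ_iff.mp hj)]

/-- The squared L² norm of the `k`-th derivative of a Bézier curve is a quadratic form
in the `k`-th order forward finite differences of its control points. -/
theorem bezier_deriv_norm_sq (d n k : ℕ) (hk : k ≤ n)
    (p q : ℕ → EuclideanSpace ℝ (Fin d))
    (hq : ∀ i ≤ n - k, q i = ∑ j ∈ Finset.range (k + 1),
      ((k.choose j : ℝ) * (-1 : ℝ) ^ (k - j)) • p (i + j)) :
    ∫ t in (0:ℝ)..1, ‖iteratedDeriv k (fun s => bezier d n p s) t‖ ^ 2 =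
      ((n.factorial : ℝ) / ((n - k).factorial : ℝ)) ^ 2 *
        ∑ i ∈ Finset.range (n - k + 1), ∑ j ∈ Finset.range (n - k + 1),
          (1 / (2 * ((n : ℝ) - (k : ℝ)) + 1)) *
            (((n - k).choose i : ℝ) * ((n - k).choose j : ℝ)) /
              ((2 * (n - k)).choose (i + j) : ℝ) * ⟪q i, q j⟫ := by
  have hdiff : ∀ i ≤ n - k, q i = (fwdDiff 1)^[k] p i := fun i hi => by
    rw [hq i hi, fwdDiff_iter_eq_sum_shift]
    refine Finset.sum_congr rfl fun j _ => ?_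
    rw [← Int.cast_smul_eq_zsmul ℝ]
    push_cast
    rw [mul_comm, smul_eq_mul, mul_one]
  have hfact : (n.descFactorial k : ℝ) = n.factorial / (n - k).factorial := by
    rw [eq_div_iff (by positivity), mul_comm]
    exact_mod_cast Nat.factorial_mul_descFactorial hk
  have hderiv := iteratedDeriv_bezier d n hk p
  simp only [hderiv, norm_smul, mul_pow, Real.norm_eq_abs, sq_abs]
  rw [intervalIntegral.integral_const_mul, integral_norm_bezier_sq, hfact, Nat.cast_sub hk]
  congr 1
  refine Finset.sum_congr rfl fun i hi => Finset.sum_congr rfl fun j hj => ?_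
  rw [hdiff i (Finset.mem_range_succ_iff.mp hi), hdiff j (Finset.mem_range_succ_iff.mp hj)]
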